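/- For every ν ∈ [0,4] there exists a constant C > 0 such that for all τ > 0, all λ > 0, and all t > 0 one has (∫_0^t ψ_{τ,λ}(s)² ds)^{1/2} ≤ C · τ^{ν/4} · λ^{(ν−2)/2}, where ψ_{τ,λ}(s) = exp(−s·λ²) − (1 + τ·λ²)^{−k} with k = ⌊s/τ⌋ + 1. -/

import Mathlib

open Real intervalIntegral

/-- Both the exponential and its backward Euler approximation decay like `1 / (1 + s m)`. -/
theorem abs_exp_sub_euler_le_inv {τ m s : ℝ} (hτ : 0 < τ) (hm : 0 < m) (hs : 0 ≤ s) :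
    |Real.exp (-(s * m)) - ((1 + τ * m) ^ (⌊s / τ⌋₊ + 1))⁻¹| ≤ (1 + s * m)⁻¹ := by
  have hsm : 0 ≤ s * m := by positivity
  have hx : 0 < τ * m := by positivity
  have hk : s ≤ ((⌊s / τ⌋₊ + 1 : ℕ) : ℝ) * τ := by
    have := (Nat.lt_floor_add_one (s / τ)).le
    rw [div_le_iff₀ hτ] at this
    exact_mod_cast this
  generalize ⌊s / τ⌋₊ + 1 = k at hk ⊢
  have hb : 1 + s * m ≤ (1 + τ * m) ^ k := by
    have h := one_add_mul_le_pow (by linarith : (-2 : ℝ) ≤ τ * m) k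
    nlinarith
  have h1 : ((1 + τ * m) ^ k)⁻¹ ≤ (1 + s * m)⁻¹ := inv_anti₀ (by positivity) hb
  have h2 : Real.exp (-(s * m)) ≤ (1 + s * m)⁻¹ := by
    rw [Real.exp_neg]
    exact inv_anti₀ (by positivity) (by linarith [Real.add_one_le_exp (s * m)])
  have h3 : 0 < ((1 + τ * m) ^ k)⁻¹ := by positivity
  have h4 := Real.exp_pos (-(s * m))
  rw [abs_le]
  constructor <;> linarith

theorem abs_exp_neg_sub_exp_neg_le {a b c d : ℝ} (ha : c ≤ a) (hb : c ≤ b) (hd : |a - b| ≤ d) :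
    |Real.exp (-a) - Real.exp (-b)| ≤ d * Real.exp (-c) := by
  have key : ∀ u v : ℝ, c ≤ u → |u - v| ≤ d →
      Real.exp (-u) - Real.exp (-v) ≤ d * Real.exp (-c) := by
    intro u v hu huv
    have h1 : Real.exp (-v) = Real.exp (-u) * Real.exp (u - v) := by
      rw [← Real.exp_add]; ring_nf
    have h2 := Real.add_one_le_exp (u - v)
    have h3 : Real.exp (-u) ≤ Real.exp (-c) := Real.exp_le_exp.mpr (by linarith)
    have h4 := Real.exp_pos (-u)
    have h5 : 0 ≤ d := (abs_nonneg _).trans huv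
    have h6 := (abs_le.mp huv).1
    calc Real.exp (-u) - Real.exp (-v) ≤ d * Real.exp (-u) := by rw [h1]; nlinarith
      _ ≤ d * Real.exp (-c) := by gcongr
  rw [abs_le]
  constructor
  · linarith [key b a hb (by rwa [abs_sub_comm])]
  · exact key a b ha hd

/-- First-order accuracy of backward Euler, for step sizes with `τ m ≤ 1`. -/
theorem abs_exp_sub_euler_le_mul_inv {τ m s : ℝ} (hτ : 0 < τ) (hm : 0 < m) (hs : 0 ≤ s)
    (hx1 : τ * m ≤ 1) :
    |Real.exp (-(s * m)) - ((1 + τ * m) ^ (⌊s / τ⌋₊ + 1))⁻¹|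
      ≤ 4 * (τ * m) * (1 + s * m)⁻¹ := by
  have hy : 0 ≤ s * m := by positivity
  have hx : 0 < τ * m := by positivity
  have hk : s ≤ ((⌊s / τ⌋₊ + 1 : ℕ) : ℝ) * τ := by
    have := (Nat.lt_floor_add_one (s / τ)).le
    rw [div_le_iff₀ hτ] at this
    exact_mod_cast this
  have hk' : ((⌊s / τ⌋₊ + 1 : ℕ) : ℝ) * τ ≤ s + τ := by
    have := Nat.floor_le (div_nonneg hs hτ.le)
    rw [le_div_iff₀ hτ] at this
    push_cast
    linarith
  generalize ⌊s / τ⌋₊ + 1 = k at hk hk' ⊢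
  have hkx : s * m ≤ k * (τ * m) := by nlinarith
  have hkx' : k * (τ * m) ≤ s * m + τ * m := by nlinarith
  have hpow : ((1 + τ * m) ^ k)⁻¹ = Real.exp (-(k * Real.log (1 + τ * m))) := by
    rw [Real.exp_neg, Real.exp_nat_mul, Real.exp_log (by positivity)]
  rw [hpow]
  generalize s * m = y at *
  generalize τ * m = x at *
  have hL1 : Real.log (1 + x) ≤ x := by
    linarith [Real.log_le_sub_one_of_pos (by positivity : 0 < 1 + x)]
  have hL2 : x - x ^ 2 / 2 ≤ Real.log (1 + x) := by
    refine le_trans ?_ (Real.le_log_one_add_of_nonneg hx.le)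
    rw [le_div_iff₀ (by positivity)]
    nlinarith [pow_pos hx 3]
  have hk0 : (0 : ℝ) ≤ k := k.cast_nonneg
  have hb1 : k * Real.log (1 + x) ≤ k * x := by gcongr
  have hb2 : k * x - k * x * x / 2 ≤ k * Real.log (1 + x) := by nlinarith
  have hd : |y - k * Real.log (1 + x)| ≤ x * (3 / 2 + y / 2) := by
    rw [abs_le]
    constructor <;> nlinarith
  have hc : y / 2 ≤ k * Real.log (1 + x) := by
    nlinarith [mul_nonneg hk0 hx.le]
  refine (abs_exp_neg_sub_exp_neg_le (by linarith : y / 2 ≤ y) hc hd).trans ?_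
  have he := Real.quadratic_le_exp_of_nonneg (by positivity : 0 ≤ y / 2)
  rw [Real.exp_neg, ← div_eq_mul_inv, ← div_eq_mul_inv,
    div_le_div_iff₀ (Real.exp_pos _) (by positivity)]
  have h : (3 / 2 + y / 2) * (1 + y) ≤ 4 * Real.exp (y / 2) := by nlinarith
  nlinarith

theorem abs_exp_sub_euler_le_rpow {τ m s p : ℝ} (hτ : 0 < τ) (hm : 0 < m) (hs : 0 ≤ s)
    (hp0 : 0 ≤ p) (hp1 : p ≤ 1) :
    |Real.exp (-(s * m)) - ((1 + τ * m) ^ (⌊s / τ⌋₊ + 1))⁻¹|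
      ≤ 4 * (τ * m) ^ p * (1 + s * m)⁻¹ := by
  have hx : 0 < τ * m := by positivity
  have hy : 0 ≤ s * m := by positivity
  rcases le_total (τ * m) 1 with h | h
  · refine (abs_exp_sub_euler_le_mul_inv hτ hm hs h).trans ?_
    have := Real.rpow_le_rpow_of_exponent_ge hx h hp1
    rw [Real.rpow_one] at this
    gcongr
  · refine (abs_exp_sub_euler_le_inv hτ hm hs).trans ?_
    have := Real.one_le_rpow h hp0
    exact le_mul_of_one_le_left (by positivity) (by linarith)

theorem intervalIntegrable_one_add_mul_inv_sq {m t : ℝ} (hm : 0 < m) (ht : 0 < t) :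
    IntervalIntegrable (fun s : ℝ => ((1 + s * m)⁻¹) ^ 2) MeasureTheory.volume 0 t := by
  apply ContinuousOn.intervalIntegrable
  rw [Set.uIcc_of_le ht.le]
  refine (ContinuousOn.inv₀ (by fun_prop) ?_).pow 2
  intro s hs
  have := mul_nonneg hs.1 hm.le
  positivity

theorem integral_one_add_mul_inv_sq_le {m t : ℝ} (hm : 0 < m) (ht : 0 < t) :
    ∫ s in (0 : ℝ)..t, ((1 + s * m)⁻¹) ^ 2 ≤ m⁻¹ := by
  have hderiv : ∀ s ∈ Set.uIcc 0 t,
      HasDerivAt (fun s : ℝ => -(m⁻¹ * (1 + s * m)⁻¹)) (((1 + s * m)⁻¹) ^ 2) s := by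
    intro s hs
    rw [Set.uIcc_of_le ht.le] at hs
    have hne : 1 + s * m ≠ 0 := by
      have := mul_nonneg hs.1 hm.le
      positivity
    have h := (((((hasDerivAt_id s).mul_const m).const_add 1).fun_inv hne).const_mul m⁻¹).fun_neg
    refine h.congr_deriv ?_
    simp only [id]
    field_simp
  rw [integral_eq_sub_of_hasDerivAt hderiv (intervalIntegrable_one_add_mul_inv_sq hm ht)]
  have : 0 ≤ m⁻¹ * (1 + t * m)⁻¹ := by positivity
  simp only [zero_mul, add_zero, inv_one, mul_one]
  linarith

theorem fully_discrete_error_operator_v (ν : ℝ) (hν : ν ∈ Set.Icc (0 : ℝ) 4) :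
    ∃ C > (0 : ℝ), ∀ τ > (0 : ℝ), ∀ l > (0 : ℝ), ∀ t > (0 : ℝ),
      (∫ s in (0 : ℝ)..t,
          (Real.exp (-(s * l ^ 2)) - ((1 + τ * l ^ 2) ^ (⌊s / τ⌋₊ + 1))⁻¹) ^ 2) ^ ((1 : ℝ) / 2)
        ≤ C * τ ^ (ν / 4) * l ^ ((ν - 2) / 2) := by
  refine ⟨4, by norm_num, fun τ hτ l hl t ht => ?_⟩
  have hm : 0 < l ^ 2 := by positivity
  set K : ℝ := 4 * (τ * l ^ 2) ^ (ν / 4) with hK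
  have hK0 : 0 ≤ K := by positivity
  have hint : ∫ s in (0 : ℝ)..t,
      (Real.exp (-(s * l ^ 2)) - ((1 + τ * l ^ 2) ^ (⌊s / τ⌋₊ + 1))⁻¹) ^ 2 ≤ (K * l⁻¹) ^ 2 := by
    calc _ ≤ ∫ s in (0 : ℝ)..t, K ^ 2 * ((1 + s * l ^ 2)⁻¹) ^ 2 := by
          rw [integral_of_le ht.le, integral_of_le ht.le]
          refine MeasureTheory.integral_mono_of_nonneg
            (Filter.Eventually.of_forall fun s => sq_nonneg _)
            ((intervalIntegrable_one_add_mul_inv_sq hm ht).const_mul _).1 ?_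
          filter_upwards [MeasureTheory.ae_restrict_mem measurableSet_Ioc] with s hs
          rw [← mul_pow, ← sq_abs]
          exact pow_le_pow_left₀ (abs_nonneg _) (abs_exp_sub_euler_le_rpow hτ hm hs.1.le
            (by linarith [hν.1]) (by linarith [hν.2])) 2
      _ ≤ K ^ 2 * (l ^ 2)⁻¹ := by
          rw [integral_const_mul]
          gcongr
          exact integral_one_add_mul_inv_sq_le hm ht
      _ = (K * l⁻¹) ^ 2 := by rw [mul_pow K, inv_pow]
  rw [← Real.sqrt_eq_rpow]
  refine (Real.sqrt_le_iff.mpr ⟨by positivity, hint⟩).trans_eq ?_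
  rw [hK, Real.mul_rpow hτ.le hm.le, ← Real.rpow_natCast, ← Real.rpow_mul hl.le,
    ← Real.rpow_neg_one l, mul_assoc, mul_assoc, ← Real.rpow_add hl, ← mul_assoc]
  congr 2
  push_cast
  ring
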